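/- Let n ≥ 1, 0 < α < 2n, 1 < p₁, p₂ < ∞. There is a constant c > 0 depending only on n, α, p₁, p₂ such that: whenever b ∈ BMO(ℝⁿ) with ‖b‖_* = 1, 0 < ε < 1, Q is a cube with center x_Q satisfying |Q|⁻¹ ∫_Q |b(y) − b_Q| dy > ε^{1/2}, f_i(y) = |Q|^{−1/p_i}(sgn(b(y) − b_Q) − c₀) χ_Q(y) for i = 1,2 with c₀ = |Q|⁻¹ ∫_Q sgn(b(y) − b_Q) dy, and x ∈ (2√n Q)^c, then |I_α((b − b_Q) f₁, (b − b_Q) f₂)(x)| ≥ c ε |Q|^{1/p₁' + 1/p₂'} |x − x_Q|^{−2n + α}, where 1/p_i' = 1 − 1/p_i. -/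

import Mathlib

open MeasureTheory Filter
open scoped ENNReal Topology

noncomputable section

/-- Euclidean space `ℝⁿ`. -/
abbrev Rn (n : ℕ) := EuclideanSpace ℝ (Fin n)

/-- Axis-parallel closed cube with center `c` and side length `r`. -/
def cube (n : ℕ) (c : Rn n) (r : ℝ) : Set (Rn n) := {y | ∀ i, |y i - c i| ≤ r / 2}

/-- Average of `b` over a set `Q`. -/
def avg (n : ℕ) (b : Rn n → ℝ) (Q : Set (Rn n)) : ℝ :=
  (volume Q).toReal⁻¹ * ∫ x in Q, b x

/-- Mean oscillation of `b` over a set `Q`. -/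
def osc (n : ℕ) (b : Rn n → ℝ) (Q : Set (Rn n)) : ℝ :=
  (volume Q).toReal⁻¹ * ∫ x in Q, |b x - avg n b Q|

/-- The BMO seminorm `‖b‖_*`, as an extended real number (supremum of the mean
oscillations over all cubes). -/
def bmoNorm (n : ℕ) (b : Rn n → ℝ) : ℝ≥0∞ :=
  ⨆ (c : Rn n) (r : {r : ℝ // 0 < r}), ENNReal.ofReal (osc n b (cube n c r.1))

/-- `b ∈ BMO(ℝⁿ)`. -/
def MemBMO (n : ℕ) (b : Rn n → ℝ) : Prop :=
  LocallyIntegrable b volume ∧ bmoNorm n b < ⊤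

/-- `b ∈ CMO(ℝⁿ)`: `b` lies in the closure of `C_c^∞(ℝⁿ)` in the BMO seminorm. -/
def MemCMO (n : ℕ) (b : Rn n → ℝ) : Prop :=
  LocallyIntegrable b volume ∧
  ∀ ε : ℝ, 0 < ε → ∃ g : Rn n → ℝ, ContDiff ℝ (⊤ : ℕ∞) g ∧ HasCompactSupport g ∧
    bmoNorm n (fun x => b x - g x) ≤ ENNReal.ofReal ε

/-- The bilinear fractional integral operator `B_α`. -/
def Bop (n : ℕ) (α : ℝ) (f g : Rn n → ℝ) (x : Rn n) : ℝ :=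
  ∫ y, f (x - y) * g (x + y) * ‖y‖ ^ (α - n)

/-- The first commutator `[b, B_α]₁`. -/
def commB (n : ℕ) (α : ℝ) (b f g : Rn n → ℝ) (x : Rn n) : ℝ :=
  ∫ y, (b x - b y) * f y * g ((2 : ℝ) • x - y) * ‖x - y‖ ^ (α - n)

/-- The bilinear fractional integral operator `I_α`. -/
def Iop (n : ℕ) (α : ℝ) (f₁ f₂ : Rn n → ℝ) (x : Rn n) : ℝ :=
  ∫ y₁, ∫ y₂, f₁ y₁ * f₂ y₂ * (‖x - y₁‖ ^ 2 + ‖x - y₂‖ ^ 2) ^ (α / 2 - n)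

/-- The iterated commutator `[Πb⃗, I_α]` with `b⃗ = (b, b)`. -/
def commI (n : ℕ) (α : ℝ) (b f₁ f₂ : Rn n → ℝ) (x : Rn n) : ℝ :=
  ∫ y₁, ∫ y₂, (b x - b y₁) * (b x - b y₂) * f₁ y₁ * f₂ y₂ *
    (‖x - y₁‖ ^ 2 + ‖x - y₂‖ ^ 2) ^ (α / 2 - n)

/-- The Muckenhoupt class `A_p`. -/
def MemAp (n : ℕ) (p : ℝ) (w : Rn n → ℝ) : Prop :=
  ∃ C : ℝ, ∀ (c : Rn n) (r : ℝ), 0 < r →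
    ((volume (cube n c r)).toReal⁻¹ * ∫ x in cube n c r, w x) *
      ((volume (cube n c r)).toReal⁻¹ * ∫ x in cube n c r, w x ^ (-(1 / (p - 1)))) ^ (p - 1) ≤ C

/-- The bilinear weight class `A_{P,q}` with `P = (p₁, p₂)`. -/
def MemAPq (n : ℕ) (p₁ p₂ q : ℝ) (w₁ w₂ : Rn n → ℝ) : Prop :=
  ∃ C : ℝ, ∀ (c : Rn n) (r : ℝ), 0 < r →
    ((volume (cube n c r)).toReal⁻¹ * ∫ x in cube n c r, w₁ x ^ q * w₂ x ^ q) *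
      ((volume (cube n c r)).toReal⁻¹ *
          ∫ x in cube n c r, w₁ x ^ (-(1 - 1 / p₁)⁻¹)) ^ (q * (1 - 1 / p₁)) *
      ((volume (cube n c r)).toReal⁻¹ *
          ∫ x in cube n c r, w₂ x ^ (-(1 - 1 / p₂)⁻¹)) ^ (q * (1 - 1 / p₂)) ≤ C

theorem norm_sub_le_of_mem_cube {n : ℕ} {c y : Rn n} {r : ℝ} (hr : 0 < r)
    (hy : y ∈ cube n c r) : ‖y - c‖ ≤ √n * r / 2 := by
  have hsum : ∑ i, ‖(y - c) i‖ ^ 2 ≤ (√n * r / 2) ^ 2 := by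
    calc ∑ i, ‖(y - c) i‖ ^ 2 ≤ ∑ _i : Fin n, (r / 2) ^ 2 := by
          refine Finset.sum_le_sum fun i _ => ?_
          exact pow_le_pow_left₀ (norm_nonneg _) (hy i) 2
      _ = (√n * r / 2) ^ 2 := by
          rw [Finset.sum_const, Finset.card_univ, Fintype.card_fin, nsmul_eq_mul, div_pow, div_pow,
            mul_pow, Real.sq_sqrt n.cast_nonneg]
          ring
  rw [EuclideanSpace.norm_eq]
  exact Real.sqrt_le_iff.2 ⟨by positivity, hsum⟩

theorem lt_norm_sub_of_notMem_cube {n : ℕ} {c x : Rn n} {r : ℝ}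
    (hx : x ∉ cube n c r) : r / 2 < ‖x - c‖ := by
  simp only [cube, Set.mem_ofPred_eq, not_forall, not_le] at hx
  obtain ⟨i, hi⟩ := hx
  exact hi.trans_le (PiLp.norm_apply_le (x - c) i)

theorem isClosed_cube (n : ℕ) (c : Rn n) (r : ℝ) : IsClosed (cube n c r) := by
  simp only [cube, Set.ofPred_forall]
  exact isClosed_iInter fun i => isClosed_le (by fun_prop) continuous_const

theorem isCompact_cube {n : ℕ} (c : Rn n) {r : ℝ} (hr : 0 < r) : IsCompact (cube n c r) :=
  (isCompact_closedBall c (√n * r / 2)).of_isClosed_subset (isClosed_cube n c r) fun y hy => by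
    rw [Metric.mem_closedBall, dist_eq_norm]
    exact norm_sub_le_of_mem_cube hr hy

theorem abs_average_sign_le_one {n : ℕ} (h : Rn n → ℝ) (Q : Set (Rn n)) :
    |(volume Q).toReal⁻¹ * ∫ z in Q, Real.sign (h z)| ≤ 1 := by
  by_cases hV : (volume Q).toReal = 0
  · simp [hV]
  have hfin : volume Q < ⊤ := lt_top_iff_ne_top.2 fun h => hV (by simp [h])
  have hle : ‖∫ z in Q, Real.sign (h z)‖ ≤ 1 * volume.real Q := by
    refine norm_setIntegral_le_of_norm_le_const hfin fun z _ => ?_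
    rcases Real.sign_apply_eq (h z) with h | h | h <;> simp [h]
  have hpos : 0 < (volume Q).toReal := lt_of_le_of_ne ENNReal.toReal_nonneg (Ne.symm hV)
  rw [Measure.real, one_mul, Real.norm_eq_abs] at hle
  rw [abs_mul, abs_inv, abs_of_pos hpos, inv_mul_le_iff₀ hpos, mul_one]
  exact hle

theorem mul_sign_sub_eq (u v : ℝ) : u * (Real.sign u - v) = |u| - v * u := by
  rcases lt_trichotomy u 0 with h | h | h
  · rw [Real.sign_of_neg h, abs_of_neg h]; ring
  · simp [h]
  · rw [Real.sign_of_pos h, abs_of_pos h]; ring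

theorem mul_sign_sub_nonneg (u : ℝ) {v : ℝ} (hv : |v| ≤ 1) : 0 ≤ u * (Real.sign u - v) := by
  rw [mul_sign_sub_eq, sub_nonneg]
  calc v * u ≤ |v| * |u| := (le_abs_self _).trans_eq (abs_mul v u)
    _ ≤ |u| := mul_le_of_le_one_left (abs_nonneg u) hv

theorem integral_sub_avg_eq_zero {n : ℕ} {b : Rn n → ℝ} {Q : Set (Rn n)}
    (hb : IntegrableOn b Q volume) (hV : (volume Q).toReal ≠ 0) :
    ∫ y in Q, (b y - avg n b Q) = 0 := by
  have hfin : volume Q ≠ ⊤ := fun h => hV (by simp [h])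
  rw [integral_sub hb (integrableOn_const hfin), setIntegral_const, avg, Measure.real,
    smul_eq_mul, mul_inv_cancel_left₀ hV, sub_self]

/-- The function `(b - b_Q) f`, where `f` is the rescaled sign test function of `b - b_Q`, is
nonnegative and integrable, and its integral is a multiple of the mean oscillation. -/
theorem sign_test_function_properties {n : ℕ} {b : Rn n → ℝ} {Q : Set (Rn n)} (p : ℝ)
    (hQ : MeasurableSet Q) (hb : IntegrableOn b Q volume) (hV : (volume Q).toReal ≠ 0)
    {f : Rn n → ℝ}
    (hf : f = Q.indicator fun y => (b y - avg n b Q) * ((volume Q).toReal ^ (-(1 / p)) *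
      (Real.sign (b y - avg n b Q) -
        (volume Q).toReal⁻¹ * ∫ z in Q, Real.sign (b z - avg n b Q)))) :
    (∀ y, 0 ≤ f y) ∧ Integrable f volume ∧
      ∫ y, f y = (volume Q).toReal ^ (1 - 1 / p) * osc n b Q := by
  have hV0 : 0 < (volume Q).toReal := lt_of_le_of_ne ENNReal.toReal_nonneg (Ne.symm hV)
  have hfin : volume Q ≠ ⊤ := fun h => hV (by simp [h])
  have hc := abs_average_sign_le_one (fun z => b z - avg n b Q) Q
  have hzero := integral_sub_avg_eq_zero hb hV
  have hosc : ∫ y in Q, |b y - avg n b Q| = (volume Q).toReal * osc n b Q := by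
    rw [osc, mul_inv_cancel_left₀ hV]
  set c₀ := (volume Q).toReal⁻¹ * ∫ z in Q, Real.sign (b z - avg n b Q)
  have hi : IntegrableOn (fun y => b y - avg n b Q) Q volume := hb.sub (integrableOn_const hfin)
  have heq : f = Q.indicator fun y => (volume Q).toReal ^ (-(1 / p)) *
      (|b y - avg n b Q| - c₀ * (b y - avg n b Q)) := by
    rw [hf]
    congr 1
    funext y
    rw [mul_left_comm, mul_sign_sub_eq]
  refine ⟨fun y => ?_, ?_, ?_⟩
  · rw [hf]
    refine Set.indicator_nonneg (fun y _ => ?_) y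
    rw [mul_left_comm]
    exact mul_nonneg (by positivity) (mul_sign_sub_nonneg _ hc)
  · rw [heq, integrable_indicator_iff hQ]
    exact (hi.abs.sub (hi.const_mul c₀)).const_mul _
  · rw [heq, integral_indicator hQ, integral_const_mul, integral_sub hi.abs (hi.const_mul c₀),
      integral_const_mul, hzero, hosc, mul_zero, sub_zero, ← mul_assoc,
      ← Real.rpow_add_one hV, neg_add_eq_sub]

theorem le_Iop_of_nonneg {n : ℕ} {α : ℝ} (hαn : α < 2 * n) {c x : Rn n} {Q : Set (Rn n)}
    (hx : 0 < ‖x - c‖) (hQ : ∀ y ∈ Q, ‖y - c‖ ≤ ‖x - c‖ / 2) {f g : Rn n → ℝ}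
    (hf0 : ∀ y, 0 ≤ f y) (hg0 : ∀ y, 0 ≤ g y) (hf : Integrable f volume)
    (hg : Integrable g volume) (hfQ : ∀ y ∉ Q, f y = 0) (hgQ : ∀ y ∉ Q, g y = 0) :
    8 ^ (α / 2 - n) * ‖x - c‖ ^ (-(2 * n) + α) * ((∫ y, f y) * ∫ y, g y) ≤ Iop n α f g x := by
  set d := ‖x - c‖ with hd
  have hexp : α / 2 - n ≤ 0 := by linarith
  have hdist : ∀ y ∈ Q, d / 2 ≤ ‖x - y‖ ∧ ‖x - y‖ ≤ 2 * d := fun y hy => by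
    have h := hQ y hy
    have h₁ := norm_sub_norm_le (x - c) (y - c)
    have h₂ := norm_sub_le (x - c) (y - c)
    rw [sub_sub_sub_cancel_right] at h₁ h₂
    constructor <;> linarith
  set K : Rn n × Rn n → ℝ := fun z => (‖x - z.1‖ ^ 2 + ‖x - z.2‖ ^ 2) ^ (α / 2 - n) with hK
  have hKm : Measurable K := by
    apply Measurable.pow_const
    fun_prop
  have hbase : ∀ y ∈ Q, ∀ z ∈ Q, d ^ 2 / 2 ≤ ‖x - y‖ ^ 2 + ‖x - z‖ ^ 2 ∧
      ‖x - y‖ ^ 2 + ‖x - z‖ ^ 2 ≤ 8 * d ^ 2 := fun y hy z hz => by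
    obtain ⟨h₁, h₂⟩ := hdist y hy
    obtain ⟨h₃, h₄⟩ := hdist z hz
    constructor <;> nlinarith
  have hfg : Integrable (fun z : Rn n × Rn n => f z.1 * g z.2) (volume.prod volume) :=
    hf.mul_prod hg
  have hfg0 : ∀ z : Rn n × Rn n, 0 ≤ f z.1 * g z.2 := fun z => mul_nonneg (hf0 _) (hg0 _)
  have hcases : ∀ z : Rn n × Rn n, f z.1 * g z.2 = 0 ∨ (z.1 ∈ Q ∧ z.2 ∈ Q) := fun z => by
    by_cases h₁ : z.1 ∈ Q
    · by_cases h₂ : z.2 ∈ Q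
      · exact Or.inr ⟨h₁, h₂⟩
      · exact Or.inl (by rw [hgQ _ h₂, mul_zero])
    · exact Or.inl (by rw [hfQ _ h₁, zero_mul])
  have hint : Integrable (fun z : Rn n × Rn n => f z.1 * g z.2 * K z) (volume.prod volume) := by
    refine (hfg.mul_const ((d ^ 2 / 2) ^ (α / 2 - n))).mono'
      (hfg.aestronglyMeasurable.mul hKm.aestronglyMeasurable) (ae_of_all _ fun z => ?_)
    have hK0 : 0 ≤ K z := by positivity
    rw [Real.norm_of_nonneg (mul_nonneg (hfg0 z) hK0)]
    rcases hcases z with h | ⟨h₁, h₂⟩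
    · simp [h]
    · exact mul_le_mul_of_nonneg_left
        (Real.rpow_le_rpow_of_nonpos (by positivity) (hbase _ h₁ _ h₂).1 hexp) (hfg0 z)
  have hconst : (8 * d ^ 2) ^ (α / 2 - n) = 8 ^ (α / 2 - n) * d ^ (-(2 * n) + α) := by
    rw [Real.mul_rpow (by norm_num) (by positivity), ← Real.rpow_natCast, ← Real.rpow_mul hx.le]
    congr 2
    push_cast
    ring
  have hI : Iop n α f g x = ∫ z, f z.1 * g z.2 * K z ∂(volume.prod volume) :=
    (integral_prod _ hint).symm
  rw [hI, ← hconst, ← integral_prod_mul, ← integral_const_mul]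
  refine integral_mono (hfg.const_mul _) hint fun z => ?_
  rcases hcases z with h | ⟨h₁, h₂⟩
  · simp [h]
  · have hb := hbase _ h₁ _ h₂
    have hpos : 0 < d ^ 2 / 2 := by positivity
    simp only [mul_comm ((8 * d ^ 2) ^ (α / 2 - n))]
    exact mul_le_mul_of_nonneg_left
      (Real.rpow_le_rpow_of_nonpos (hpos.trans_le hb.1) hb.2 hexp) (hfg0 z)

/-- pointwise lower bound `|I_α((b-b_Q)f₁, (b-b_Q)f₂)(x)| ≳ ε
|Q|^{1/p₁'+1/p₂'} |x - x_Q|^{-2n+α}` for `x ∈ (2√n Q)^c`, when the mean oscillation of `b`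
on `Q` exceeds `ε^{1/2}`. -/
theorem statement11 (n : ℕ) (hn : 1 ≤ n) (α p₁ p₂ : ℝ)
    (hα : 0 < α) (hαn : α < 2 * n) (hp₁ : 1 < p₁) (hp₂ : 1 < p₂) :
    ∃ C : ℝ, 0 < C ∧ ∀ (b : Rn n → ℝ) (ε : ℝ) (c : Rn n) (r : ℝ), 0 < r →
      LocallyIntegrable b volume → bmoNorm n b = 1 →
      0 < ε → ε < 1 → Real.sqrt ε < osc n b (cube n c r) →
      ∀ x : Rn n, x ∉ cube n c (2 * Real.sqrt n * r) →
        C * ε * (volume (cube n c r)).toReal ^ ((1 - 1 / p₁) + (1 - 1 / p₂)) *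
            ‖x - c‖ ^ (-(2 * n) + α) ≤
          |Iop n α
              ((cube n c r).indicator fun y =>
                (b y - avg n b (cube n c r)) *
                  ((volume (cube n c r)).toReal ^ (-(1 / p₁)) *
                    (Real.sign (b y - avg n b (cube n c r)) -
                      (volume (cube n c r)).toReal⁻¹ *
                        ∫ z in cube n c r, Real.sign (b z - avg n b (cube n c r)))))
              ((cube n c r).indicator fun y =>
                (b y - avg n b (cube n c r)) *
                  ((volume (cube n c r)).toReal ^ (-(1 / p₂)) *
                    (Real.sign (b y - avg n b (cube n c r)) -
                      (volume (cube n c r)).toReal⁻¹ *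
                        ∫ z in cube n c r, Real.sign (b z - avg n b (cube n c r)))))
              x| := by
  refine ⟨8 ^ (α / 2 - n), by positivity, fun b ε c r hr hb _ hε _ hosc x hx => ?_⟩
  have hQ := isCompact_cube c hr
  have hbQ : IntegrableOn b (cube n c r) volume := hb.integrableOn_isCompact hQ
  have hosc0 : 0 < osc n b (cube n c r) := (Real.sqrt_nonneg ε).trans_lt hosc
  have hV : (volume (cube n c r)).toReal ≠ 0 := fun h => by simp [osc, h] at hosc0
  have hV0 : 0 < (volume (cube n c r)).toReal :=
    lt_of_le_of_ne ENNReal.toReal_nonneg (Ne.symm hV)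
  have hxc : √n * r < ‖x - c‖ := by linarith [lt_norm_sub_of_notMem_cube hx]
  have hxc0 : 0 < ‖x - c‖ := lt_of_le_of_lt (by positivity) hxc
  obtain ⟨hf0, hf, hfi⟩ :=
    sign_test_function_properties p₁ hQ.measurableSet hbQ hV rfl
  obtain ⟨hg0, hg, hgi⟩ :=
    sign_test_function_properties p₂ hQ.measurableSet hbQ hV rfl
  have hmain := le_Iop_of_nonneg hαn hxc0
    (fun y hy => (norm_sub_le_of_mem_cube hr hy).trans (by linarith)) hf0 hg0 hf hg
    (fun y hy => Set.indicator_of_notMem hy _) (fun y hy => Set.indicator_of_notMem hy _)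
  refine le_trans ?_ (hmain.trans (le_abs_self _))
  rw [hfi, hgi, Real.rpow_add hV0]
  have hεosc : ε ≤ osc n b (cube n c r) ^ 2 := (Real.sqrt_le_left hosc0.le).1 hosc.le
  set V := (volume (cube n c r)).toReal
  have hnonneg : 0 ≤ 8 ^ (α / 2 - n) * ‖x - c‖ ^ (-(2 * n) + α) *
      (V ^ (1 - 1 / p₁) * V ^ (1 - 1 / p₂)) := by positivity
  calc _ = 8 ^ (α / 2 - n) * ‖x - c‖ ^ (-(2 * n) + α) *
        (V ^ (1 - 1 / p₁) * V ^ (1 - 1 / p₂)) * ε := by ring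
    _ ≤ 8 ^ (α / 2 - n) * ‖x - c‖ ^ (-(2 * n) + α) *
        (V ^ (1 - 1 / p₁) * V ^ (1 - 1 / p₂)) * osc n b (cube n c r) ^ 2 :=
      mul_le_mul_of_nonneg_left hεosc hnonneg
    _ = _ := by ring
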